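/- There do not exist positive integers n, m with m ≥ 2 and a digit d ∈ {1,...,9} such that φ(P_n) = d·(10^m − 1)/9, where P_n is the n-th Pell number and φ is the Euler totient function. In other words, the Euler totient of a Pell number is never a repdigit with at least two digits. -/

import Mathlib

def pellP : ℕ → ℕ
  | 0 => 0
  | 1 => 1
  | n + 2 => 2 * pellP (n + 1) + pellP n

def pellQ : ℕ → ℕ
  | 0 => 1
  | 1 => 1
  | n + 2 => 2 * pellQ (n + 1) + pellQ n

lemma gaussianInt_unit_cases {u : GaussianInt} (hu : IsUnit u) :
    (u.re = 1 ∧ u.im = 0) ∨ (u.re = -1 ∧ u.im = 0) ∨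
      (u.re = 0 ∧ u.im = 1) ∨ (u.re = 0 ∧ u.im = -1) := by
  have h1 : u.norm = 1 :=
    (Zsqrtd.norm_eq_one_iff' (by norm_num) u).2 hu
  rw [Zsqrtd.norm_def] at h1
  have hr : -1 ≤ u.re ∧ u.re ≤ 1 := by constructor <;> nlinarith [sq_nonneg u.im]
  have hi : -1 ≤ u.im ∧ u.im ≤ 1 := by constructor <;> nlinarith [sq_nonneg u.re]
  obtain ⟨hr1, hr2⟩ := hr
  obtain ⟨hi1, hi2⟩ := hi
  generalize u.re = a at *
  generalize u.im = b at *
  interval_cases a <;> interval_cases b <;> simp_all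

lemma sq_add_sq_eq_one_of_mul_isUnit {a b e : ℤ} (he : e = 1 ∨ e = -1)
    (h : IsUnit ((a + e * b) * (a ^ 2 - 4 * e * a * b + b ^ 2))) : a ^ 2 + b ^ 2 = 1 := by
  rw [IsUnit.mul_iff, Int.isUnit_iff, Int.isUnit_iff] at h
  obtain ⟨h1, h2⟩ := h
  have hs : (a + e * b) ^ 2 = 1 := by rcases h1 with h1 | h1 <;> rw [h1] <;> norm_num
  have hab : a * b = 0 := by
    rcases he with rfl | rfl <;> rcases h2 with h2 | h2 <;> ring_nf at hs h2 ⊢ <;> omega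
  rcases he with rfl | rfl
  · linear_combination hs - 2 * hab
  · linear_combination hs + 2 * hab

/-- `x ^ 2 + 1 = 2 * y ^ 3` in the form `(t + 1) ^ 2 + t ^ 2 = y ^ 3`, where `x = 2 * t + 1`. -/
lemma eq_one_of_succ_sq_add_sq_eq_cube {t y : ℤ} (h : (t + 1) ^ 2 + t ^ 2 = y ^ 3) : y = 1 := by
  let w : GaussianInt := ⟨t + 1, t⟩
  let v : GaussianInt := ⟨t + 1, -t⟩
  have hwv : w * v = (y : GaussianInt) ^ 3 := by
    have hn : w * v = (((t + 1) ^ 2 + t ^ 2 : ℤ) : GaussianInt) := by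
      ext
      · rw [Zsqrtd.re_intCast, Zsqrtd.re_mul]; ring
      · rw [Zsqrtd.im_intCast, Zsqrtd.im_mul]; ring
    rw [hn, h, Int.cast_pow]
  have hc : IsCoprime w v := by
    refine ⟨-⟨t ^ 2 + t, t ^ 2 + t⟩, w - ⟨t ^ 2 + t, -(t ^ 2 + t)⟩, ?_⟩
    ext
    · simp [w, v]; ring
    · simp [w, v]; ring
  obtain ⟨d, u, hu⟩ := exists_associated_pow_of_mul_eq_pow' hc hwv
  have hre := congrArg Zsqrtd.re hu
  have him := congrArg Zsqrtd.im hu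
  obtain ⟨a, b⟩ := d
  simp only [pow_succ, pow_zero, one_mul, Zsqrtd.re_mul, Zsqrtd.im_mul, w] at hre him
  have hab : a ^ 2 + b ^ 2 = 1 := by
    rcases gaussianInt_unit_cases u.isUnit with ⟨h1, h2⟩ | ⟨h1, h2⟩ | ⟨h1, h2⟩ | ⟨h1, h2⟩ <;>
      rw [h1, h2] at hre him
    · exact sq_add_sq_eq_one_of_mul_isUnit (.inl rfl)
        (Int.isUnit_iff.2 (.inl (by linear_combination hre - him)))
    · exact sq_add_sq_eq_one_of_mul_isUnit (.inl rfl)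
        (Int.isUnit_iff.2 (.inr (by linear_combination him - hre)))
    · exact sq_add_sq_eq_one_of_mul_isUnit (.inr rfl)
        (Int.isUnit_iff.2 (.inr (by linear_combination him - hre)))
    · exact sq_add_sq_eq_one_of_mul_isUnit (.inr rfl)
        (Int.isUnit_iff.2 (.inl (by linear_combination hre - him)))
  have hy : y ^ 3 = 1 := by
    have hnu : (u : GaussianInt).norm = 1 :=
      (Zsqrtd.norm_eq_one_iff' (by norm_num) _).2 u.isUnit
    have hn := congrArg Zsqrtd.norm hu
    rw [Zsqrtd.norm_mul, hnu, pow_succ, pow_succ, pow_one, Zsqrtd.norm_mul, Zsqrtd.norm_mul,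
      Zsqrtd.norm_def, Zsqrtd.norm_def] at hn
    have hd : a * a - -1 * b * b = 1 := by linear_combination hab
    simp only [hd, w] at hn
    linear_combination -h - hn
  have h1 : (y - 1) * (y ^ 2 + y + 1) = 0 := by linear_combination hy
  rcases mul_eq_zero.mp h1 with h2 | h2
  · linarith
  · nlinarith [sq_nonneg (2 * y + 1)]

lemma eq_one_of_sq_add_one_eq_two_mul_cube {x y : ℤ} (h : x ^ 2 + 1 = 2 * y ^ 3) : y = 1 := by
  rcases Int.even_or_odd' x with ⟨t, rfl | rfl⟩
  · ring_nf at h; omega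
  · exact eq_one_of_succ_sq_add_sq_eq_cube (t := t) (by linarith)

/-- `y ^ 6 + 1 = 2 * x ^ 2` only for `y ^ 2 ≤ 1`. -/
lemma sq_le_one_of_pow_six_add_one {x y : ℤ} (h : y ^ 6 + 1 = 2 * x ^ 2) : y ^ 2 ≤ 1 := by
  by_contra! hy
  obtain ⟨c, hc⟩ : ∃ c, y ^ 2 + 1 = 2 * c := by
    rcases Int.even_or_odd' y with ⟨k, rfl | rfl⟩
    · ring_nf at h; omega
    · exact ⟨2 * k ^ 2 + 2 * k + 1, by ring⟩
  have hc3 : IsCoprime c 3 := by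
    have h3 : c % 3 = 1 ∨ c % 3 = 2 := by
      have : y ^ 2 % 3 = 0 ∨ y ^ 2 % 3 = 1 := by
        have : y % 3 = 0 ∨ y % 3 = 1 ∨ y % 3 = 2 := by omega
        rcases this with h | h | h <;> simp [pow_two, Int.mul_emod, h]
      omega
    rcases h3 with h3 | h3
    · exact ⟨1, -(c / 3), by omega⟩
    · exact ⟨-1, c / 3 + 1, by omega⟩
  have hcD : IsCoprime c (y ^ 4 - y ^ 2 + 1) := by
    rw [show y ^ 4 - y ^ 2 + 1 = 3 + c * (2 * (y ^ 2 - 2)) by linear_combination (y ^ 2 - 2) * hc]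
    exact hc3.add_mul_left_right _
  have hprod : (y ^ 4 - y ^ 2 + 1) * c = x ^ 2 := by
    have : 2 * ((y ^ 4 - y ^ 2 + 1) * c) = 2 * x ^ 2 := by
      linear_combination h - (y ^ 4 - y ^ 2 + 1) * hc
    linarith
  obtain ⟨b, hb | hb⟩ := Int.sq_of_isCoprime hcD.symm hprod
  · have h1 : |y ^ 2 - 1| < |b| := sq_lt_sq.mp (by nlinarith)
    have h2 : |b| < |y ^ 2| := sq_lt_sq.mp (by nlinarith)
    rw [abs_of_pos (by linarith)] at h1
    rw [abs_of_pos (a := y ^ 2) (by linarith)] at h2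
    linarith
  · nlinarith [sq_nonneg b]

/-- One descent step for `x ^ 4 - y ^ 4 = z ^ 2` with `z` odd. -/
lemma exists_descent_of_sq_add_sq {a b x y : ℤ} (ha : 0 < a) (hb : 0 < b) (hx : 0 < x)
    (hao : a % 2 = 1) (hbe : b % 2 = 0) (hab : IsCoprime a b) (hy : y ^ 2 = 2 * a * b)
    (hxx : x ^ 2 = a ^ 2 + b ^ 2) :
    ∃ g h c : ℤ, g ^ 4 = h ^ 4 + c ^ 2 ∧ c % 2 = 1 ∧ IsCoprime h c ∧ h ≠ 0 ∧
      g.natAbs < x.natAbs := by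
  obtain ⟨b', rfl⟩ : 2 ∣ b := Int.dvd_of_emod_eq_zero hbe
  have hb' : 0 < b' := by linarith
  have hye : 2 ∣ y := by
    apply @Int.Prime.dvd_pow' _ 2 _ Nat.prime_two
    rw [hy, mul_assoc]
    exact dvd_mul_right 2 _
  obtain ⟨y', rfl⟩ := hye
  have h1 : a * b' = y' ^ 2 := by linarith
  have hab' : IsCoprime a b' := hab.of_mul_right_right
  obtain ⟨c, hc⟩ := Int.sq_of_isCoprime hab' h1
  obtain ⟨d, hd⟩ := Int.sq_of_isCoprime hab'.symm (by rw [mul_comm]; exact h1)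
  have hc : a = c ^ 2 := by
    rcases hc with hc | hc
    · exact hc
    · nlinarith [sq_nonneg c]
  have hd : b' = d ^ 2 := by
    rcases hd with hd | hd
    · exact hd
    · nlinarith [sq_nonneg d]
  subst hc hd
  have ht : PythagoreanTriple (c ^ 2) (2 * d ^ 2) x := by
    delta PythagoreanTriple
    linear_combination -hxx
  obtain ⟨e, f, h2, h3, h4, h5, -, h7⟩ :=
    ht.coprime_classification' (Int.isCoprime_iff_gcd_eq_one.mp hab) hao hx
  have hef : e * f = d ^ 2 := by linarith
  have hcop : IsCoprime e f := Int.isCoprime_iff_gcd_eq_one.mpr h5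
  have he : 0 < e := by
    rcases h7.lt_or_eq with h | h
    · exact h
    · subst h; linarith
  have hf : 0 < f := by
    by_contra! h
    nlinarith
  obtain ⟨g, hg⟩ := Int.sq_of_isCoprime hcop hef
  obtain ⟨h, hh⟩ := Int.sq_of_isCoprime hcop.symm (by rw [mul_comm]; exact hef)
  have hg : e = g ^ 2 := by
    rcases hg with hg | hg
    · exact hg
    · nlinarith [sq_nonneg g]
  have hh : f = h ^ 2 := by
    rcases hh with hh | hh
    · exact hh
    · nlinarith [sq_nonneg h]
  subst hg hh
  have hgh : IsCoprime g h := (IsCoprime.pow_iff (by norm_num) (by norm_num)).mp hcop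
  refine ⟨g, h, c, by linear_combination -h2, ?_, ?_, ?_, ?_⟩
  · rcases Int.emod_two_eq_zero_or_one c with hc | hc
    · rw [sq, Int.mul_emod, hc] at hao
      norm_num at hao
    · exact hc
  · have : IsCoprime (h ^ 4) (c ^ 2) := by
      rw [show c ^ 2 = g ^ 4 + h ^ 4 * (-1) by linear_combination h2]
      exact (IsCoprime.pow hgh.symm).add_mul_left_right (-1)
    exact (IsCoprime.pow_iff (by norm_num) (by norm_num)).mp this
  · rintro rfl
    simp at hf
  · zify
    rw [abs_of_pos hx]
    have h8 : |g| ≤ g ^ 2 := by simpa using Int.natAbs_le_self_sq g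
    nlinarith

/-- The equation `x ^ 4 = y ^ 4 + z ^ 2` has no primitive solution with `z` odd and `y ≠ 0`. -/
lemma pow_four_ne_pow_four_add_sq_of_odd {x y z : ℤ} (hz : z % 2 = 1) (hyz : IsCoprime y z)
    (hy : y ≠ 0) : x ^ 4 ≠ y ^ 4 + z ^ 2 := by
  induction hn : x.natAbs using Nat.strong_induction_on generalizing x y z with
  | _ n ih =>
  intro h
  wlog hx : 0 < x generalizing x
  · have hx0 : x ≠ 0 := by
      rintro rfl
      have := pow_pos (sq_pos_of_ne_zero hy) 2
      nlinarith [sq_nonneg z]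
    exact this (x := -x) (by simpa using hn) (by rw [← h]; ring)
      (by have := lt_of_le_of_ne (not_lt.mp hx) hx0; linarith)
  have ht : PythagoreanTriple z (y ^ 2) (x ^ 2) := by
    delta PythagoreanTriple
    linear_combination -h
  obtain ⟨a, b, h2, h3, h4, h5, h6, h7⟩ := ht.coprime_classification'
    (Int.isCoprime_iff_gcd_eq_one.mp hyz.symm.pow_right) hz (by positivity)
  have hy2 : 0 < y ^ 2 := by positivity
  have ha : 0 < a := by
    rcases h7.lt_or_eq with h | h
    · exact h
    · subst h; linarith
  have hb : 0 < b := by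
    by_contra! h
    nlinarith
  have hab : IsCoprime a b := Int.isCoprime_iff_gcd_eq_one.mpr h5
  have key : ∃ g h c : ℤ, g ^ 4 = h ^ 4 + c ^ 2 ∧ c % 2 = 1 ∧ IsCoprime h c ∧ h ≠ 0 ∧
      g.natAbs < x.natAbs := by
    rcases h6 with ⟨p, q⟩ | ⟨p, q⟩
    · exact exists_descent_of_sq_add_sq hb ha hx q p hab.symm (y := y) (by linarith) (by linarith)
    · exact exists_descent_of_sq_add_sq ha hb hx p q hab (y := y) (by linarith) (by linarith)
  obtain ⟨g, k, c, e1, e2, e3, e4, e5⟩ := key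
  exact ih _ (hn ▸ e5) e2 e3 e4 rfl e1

lemma sq_eq_one_of_pow_four_add_one {x y : ℤ} (h : y ^ 4 + 1 = 2 * x ^ 2) : y ^ 2 = 1 := by
  by_contra hne
  have hx0 : x ≠ 0 := by
    rintro rfl
    nlinarith [sq_nonneg (y ^ 2)]
  have hyo : y % 2 = 1 := by
    rcases Int.emod_two_eq_zero_or_one y with hy | hy
    · have := congrArg (· % 2) h
      simp [Int.add_emod, pow_succ, Int.mul_emod, hy] at this
    · exact hy
  obtain ⟨k, hk⟩ : ∃ k, y = 2 * k + 1 := ⟨y / 2, by omega⟩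
  obtain ⟨z, hz⟩ : ∃ z, y ^ 4 = 2 * z + 1 :=
    ⟨8 * k ^ 4 + 16 * k ^ 3 + 12 * k ^ 2 + 4 * k, by rw [hk]; ring⟩
  have hxz : x ^ 2 = z + 1 := by linarith
  have ht : PythagoreanTriple (y ^ 2) z (x ^ 2) := by
    delta PythagoreanTriple
    rw [hxz]
    linear_combination hz
  have hc : IsCoprime (y ^ 2) z :=
    ⟨y ^ 2, -2, by linear_combination hz⟩
  have hy2 : y ^ 2 % 2 = 1 := by rw [sq, Int.mul_emod, hyo]; rfl
  obtain ⟨a, b, h2, -, h4, h5, -, -⟩ := ht.coprime_classification'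
    (Int.isCoprime_iff_gcd_eq_one.mp hc) hy2 (by positivity)
  have hab : IsCoprime a b := Int.isCoprime_iff_gcd_eq_one.mpr h5
  have e : a ^ 4 = b ^ 4 + (y * x) ^ 2 := by
    rw [mul_pow, h2, h4]; ring
  refine pow_four_ne_pow_four_add_sq_of_odd (x := a) (y := b) (z := y * x) ?_ ?_ ?_ e
  · have hxo : x % 2 = 1 := by
      rcases Int.emod_two_eq_zero_or_one x with hx | hx
      · obtain ⟨j, rfl⟩ := Int.dvd_of_emod_eq_zero hx
        have h8 : 2 * (8 * k ^ 4 + 16 * k ^ 3 + 12 * k ^ 2 + 4 * k + 1) = 8 * j ^ 2 := by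
          rw [hk] at h
          linear_combination h
        omega
      · exact hx
    rw [Int.mul_emod, hyo, hxo]; rfl
  · have : IsCoprime (b ^ 4) ((y * x) ^ 2) := by
      rw [show (y * x) ^ 2 = a ^ 4 + b ^ 4 * (-1) by linear_combination -e]
      exact (IsCoprime.pow hab.symm).add_mul_left_right (-1)
    exact (IsCoprime.pow_iff (by norm_num) (by norm_num)).mp this
  · rintro rfl
    apply hne
    have : x ^ 2 = y ^ 2 := by rw [h2, h4]; ring
    rw [this] at h
    nlinarith [sq_nonneg (y ^ 2 - 1), mul_self_eq_zero.mp (show (y ^ 2 - 1) * (y ^ 2 - 1) = 0 by linear_combination h)]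

lemma pellP_pellQ_succ (n : ℕ) :
    pellP (n + 1) = pellP n + pellQ n ∧ pellQ (n + 1) = 2 * pellP n + pellQ n := by
  induction n with
  | zero => simp [pellP, pellQ]
  | succ n ih =>
    obtain ⟨h1, h2⟩ := ih
    rw [pellP, pellQ]
    constructor <;> omega

lemma pellP_pellQ_add (m n : ℕ) :
    pellP (m + n) = pellP m * pellQ n + pellQ m * pellP n ∧
      pellQ (m + n) = pellQ m * pellQ n + 2 * pellP m * pellP n := by
  induction n with
  | zero => simp [pellP, pellQ]
  | succ n ih =>
    rw [← add_assoc, (pellP_pellQ_succ _).1, (pellP_pellQ_succ (m + n)).2, (pellP_pellQ_succ n).1,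
      (pellP_pellQ_succ n).2, ih.1, ih.2]
    constructor <;> ring

lemma pellP_two_mul (n : ℕ) : pellP (2 * n) = 2 * (pellP n * pellQ n) := by
  rw [two_mul, (pellP_pellQ_add n n).1]
  ring

lemma pellP_pos {n : ℕ} (hn : 0 < n) : 0 < pellP n := by
  induction n, hn using Nat.le_induction with
  | base => simp [pellP]
  | succ n _ ih => rw [(pellP_pellQ_succ n).1]; omega

lemma pellQ_pos (n : ℕ) : 0 < pellQ n := by
  induction n with
  | zero => simp [pellQ]
  | succ n ih => rw [(pellP_pellQ_succ n).2]; omega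

lemma strictMono_pellP : StrictMono pellP :=
  strictMono_nat_of_lt_succ fun n => by
    rw [(pellP_pellQ_succ n).1]
    have := pellQ_pos n
    omega

lemma one_lt_pellP {n : ℕ} (hn : 1 < n) : 1 < pellP n := strictMono_pellP hn

lemma one_lt_pellQ {n : ℕ} (hn : 1 < n) : 1 < pellQ n := by
  obtain ⟨n, rfl⟩ := Nat.exists_eq_add_of_lt hn
  rw [(pellP_pellQ_succ _).2]
  have := pellP_pos (n := 1 + n) (by omega)
  omega

lemma pellQ_sq_add_one {n : ℕ} (hn : Odd n) : pellQ n ^ 2 + 1 = 2 * pellP n ^ 2 := by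
  obtain ⟨k, rfl⟩ := hn
  induction k with
  | zero => simp [pellP, pellQ]
  | succ k ih =>
    rw [show 2 * (k + 1) + 1 = 2 * k + 1 + 2 by ring, (pellP_pellQ_add _ 2).1,
      (pellP_pellQ_add _ 2).2]
    simp only [pellP, pellQ]
    linarith

lemma pellP_dvd_pellP_mul (m k : ℕ) : pellP m ∣ pellP (m * k) := by
  induction k with
  | zero => simp [pellP]
  | succ k ih =>
    rw [mul_add, mul_one, (pellP_pellQ_add _ m).1]
    exact dvd_add (ih.mul_right _) (dvd_mul_left _ _)

/-- Modulo `9240 = 3 * 5 * 7 * 8 * 11` both sequences have period `24`. -/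
lemma pell_mod (n : ℕ) :
    pellP n % 9240 = pellP (n % 24) % 9240 ∧ pellQ n % 9240 = pellQ (n % 24) % 9240 := by
  induction n using Nat.strong_induction_on with
  | _ n ih =>
  rcases lt_or_ge n 24 with h | h
  · rw [Nat.mod_eq_of_lt h]; exact ⟨rfl, rfl⟩
  · obtain ⟨k, rfl⟩ := Nat.exists_eq_add_of_le' h
    rw [Nat.add_mod_right, ← (ih k (by omega)).1, ← (ih k (by omega)).2, (pellP_pellQ_add k 24).1,
      (pellP_pellQ_add k 24).2]
    have e1 : pellP 24 % 9240 = 0 := by norm_num [pellP]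
    have e2 : pellQ 24 % 9240 = 1 := by norm_num [pellQ]
    constructor
    · rw [Nat.add_mod, Nat.mul_mod, e2, Nat.mul_mod (pellQ k), e1]; simp
    · rw [Nat.add_mod, Nat.mul_mod, e2, Nat.mul_mod (2 * _), e1]; simp

/-- Residues modulo `9240` of the Pell and half-companion Pell numbers of odd index. -/
lemma pell_mod_of_odd {n : ℕ} (hn : Odd n) :
    (n % 24 = 1 ∧ pellP n % 9240 = 1 ∧ pellQ n % 9240 = 1) ∨
      (n % 24 = 3 ∧ pellP n % 9240 = 5 ∧ pellQ n % 9240 = 7) ∨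
      (n % 24 = 5 ∧ pellP n % 9240 = 29 ∧ pellQ n % 9240 = 41) ∨
      (n % 24 = 7 ∧ pellP n % 9240 = 169 ∧ pellQ n % 9240 = 239) ∨
      (n % 24 = 9 ∧ pellP n % 9240 = 985 ∧ pellQ n % 9240 = 1393) ∨
      (n % 24 = 11 ∧ pellP n % 9240 = 5741 ∧ pellQ n % 9240 = 8119) ∨
      (n % 24 = 13 ∧ pellP n % 9240 = 5741 ∧ pellQ n % 9240 = 1121) ∨
      (n % 24 = 15 ∧ pellP n % 9240 = 985 ∧ pellQ n % 9240 = 7847) ∨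
      (n % 24 = 17 ∧ pellP n % 9240 = 169 ∧ pellQ n % 9240 = 9001) ∨
      (n % 24 = 19 ∧ pellP n % 9240 = 29 ∧ pellQ n % 9240 = 9199) ∨
      (n % 24 = 21 ∧ pellP n % 9240 = 5 ∧ pellQ n % 9240 = 9233) ∨
      (n % 24 = 23 ∧ pellP n % 9240 = 1 ∧ pellQ n % 9240 = 9239) := by
  obtain ⟨h1, h2⟩ := pell_mod n
  have h24 : n % 24 < 24 := Nat.mod_lt _ (by norm_num)
  have hodd : n % 24 % 2 = 1 := by rw [Nat.odd_iff] at hn; omega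
  generalize n % 24 = r at *
  interval_cases r <;> simp_all [pellP, pellQ]

lemma pellP_mod_four {n : ℕ} (hn : Odd n) : pellP n % 4 = 1 := by
  rcases pell_mod_of_odd hn with h | h | h | h | h | h | h | h | h | h | h | h <;> omega

lemma pellP_not_three_dvd {n : ℕ} (hn : Odd n) : ¬ 3 ∣ pellP n := by
  rcases pell_mod_of_odd hn with h | h | h | h | h | h | h | h | h | h | h | h <;> omega

lemma pellQ_odd {n : ℕ} (hn : Odd n) : pellQ n % 2 = 1 := by
  rcases pell_mod_of_odd hn with h | h | h | h | h | h | h | h | h | h | h | h <;> omega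

lemma prime_mod_four_of_dvd_pellP {n p : ℕ} (hn : Odd n) (hp : p.Prime) (h : p ∣ pellP n) :
    p % 4 = 1 := by
  have := Fact.mk hp
  have h2 : p % 2 = 1 := by
    have := pellP_mod_four hn
    rcases hp.eq_two_or_odd with rfl | h'
    · omega
    · exact h'
  have h3 : p % 4 ≠ 3 := by
    refine ZMod.mod_four_ne_three_of_sq_eq_neg_one (y := (pellQ n : ZMod p)) ?_
    have e := congrArg (Nat.cast (R := ZMod p)) (pellQ_sq_add_one hn)
    push_cast at e
    rw [(ZMod.natCast_eq_zero_iff _ _).mpr h] at e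
    linear_combination e
  omega

lemma prime_mod_eight_of_dvd_pellQ {n p : ℕ} (hn : Odd n) (hp : p.Prime) (h : p ∣ pellQ n) :
    p % 8 = 1 ∨ p % 8 = 7 := by
  have := Fact.mk hp
  have h2 : p ≠ 2 := by
    rintro rfl
    have := pellQ_odd hn
    omega
  refine (ZMod.exists_sq_eq_two_iff h2).mp ⟨2 * (pellP n : ZMod p), ?_⟩
  have e := congrArg (Nat.cast (R := ZMod p)) (pellQ_sq_add_one hn)
  push_cast at e
  rw [(ZMod.natCast_eq_zero_iff _ _).mpr h] at e
  linear_combination 2 * e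

lemma coprime_pellP_pellQ {n : ℕ} (hn : Odd n) : Nat.Coprime (pellP n) (pellQ n) := by
  refine Nat.Coprime.symm (Nat.coprime_of_dvd fun p hp h1 h2 => hp.one_lt.ne' ?_)
  have h3 : p ∣ pellQ n ^ 2 + 1 := by
    rw [pellQ_sq_add_one hn]
    exact (dvd_pow h2 two_ne_zero).mul_left 2
  exact Nat.dvd_one.mp ((Nat.dvd_add_right (dvd_pow h1 two_ne_zero)).mp h3)

lemma not_three_dvd_of_pellP_eq_pow {n p k : ℕ} (hn : Odd n) (hP : 1 < pellP n)
    (h : pellP n = p ^ k) : ¬ 3 ∣ k := by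
  rintro ⟨j, rfl⟩
  have e := pellQ_sq_add_one hn
  rw [h] at e
  have h1 : ((p : ℤ) ^ j) ^ 2 = 1 :=
    eq_one_of_sq_add_one_eq_two_mul_cube (x := pellQ n)
      (by
      rw [← pow_mul, ← pow_mul, show j * (2 * 3) = 3 * j * 2 by ring, pow_mul]
      exact_mod_cast e)
  have h2 : (p ^ j) ^ 2 = 1 := by exact_mod_cast h1
  have h3 : p ^ j = 1 := by simpa using h2
  rw [h, mul_comm, pow_mul, h3, one_pow] at hP
  exact lt_irrefl _ hP

lemma not_three_dvd_of_pellQ_eq_pow {n q k : ℕ} (hn : Odd n) (hQ : 1 < pellQ n)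
    (h : pellQ n = q ^ k) : ¬ 3 ∣ k := by
  rintro ⟨j, rfl⟩
  have e := pellQ_sq_add_one hn
  have h1 : ((q : ℤ) ^ j) ^ 2 ≤ 1 :=
    sq_le_one_of_pow_six_add_one (x := pellP n)
      (by rw [← pow_mul, show j * 6 = 3 * j * 2 by ring, pow_mul]; rw [h] at e; exact_mod_cast e)
  have h2 : (q ^ j) ^ 2 ≤ 1 := by exact_mod_cast h1
  have h3 : q ^ j ≤ 1 := by nlinarith
  rw [h, mul_comm, pow_mul] at hQ
  exact absurd (pow_le_one' h3 3) (not_le.mpr hQ)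

lemma not_even_of_pellQ_eq_pow {n q k : ℕ} (hn : Odd n) (hQ : 1 < pellQ n)
    (h : pellQ n = q ^ k) : ¬ Even k := by
  rintro ⟨j, rfl⟩
  have e := pellQ_sq_add_one hn
  have h1 : ((q : ℤ) ^ j) ^ 2 = 1 :=
    sq_eq_one_of_pow_four_add_one (x := pellP n)
      (by rw [← pow_mul, show j * 4 = (j + j) * 2 by ring, pow_mul]; rw [h] at e; exact_mod_cast e)
  have h2 : (q ^ j) ^ 2 = 1 := by exact_mod_cast h1
  rw [h, ← mul_two, pow_mul, h2] at hQ
  exact lt_irrefl _ hQ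

lemma repunit_mod_hundred {R m : ℕ} (hm : 2 ≤ m) (hR : 9 * R + 1 = 10 ^ m) : R % 100 = 11 := by
  have : 100 ∣ 10 ^ m := pow_dvd_pow 10 hm
  omega

/-- Residues of repunits modulo `77`. -/
lemma repunit_mod {R m : ℕ} (hR : 9 * R + 1 = 10 ^ m) :
    (m % 6 = 0 ∧ R % 77 = 0) ∨ (m % 6 = 1 ∧ R % 77 = 1) ∨ (m % 6 = 2 ∧ R % 77 = 11) ∨
      (m % 6 = 3 ∧ R % 77 = 34) ∨ (m % 6 = 4 ∧ R % 77 = 33) ∨ (m % 6 = 5 ∧ R % 77 = 23) := by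
  have h : 10 ^ m % 693 = 10 ^ (m % 6) % 693 := by
    conv_lhs => rw [← Nat.div_add_mod m 6, pow_add, pow_mul, Nat.mul_mod, Nat.pow_mod]
    norm_num
  rw [← hR] at h
  have h6 : m % 6 < 6 := Nat.mod_lt _ (by norm_num)
  generalize m % 6 = r at *
  interval_cases r <;> norm_num at h ⊢ <;> omega

lemma eleven_dvd_of_seven_dvd {R m : ℕ} (hR : 9 * R + 1 = 10 ^ m) (h : 7 ∣ R) : 11 ∣ R := by
  have hr := repunit_mod hR
  clear hR
  omega

lemma even_of_repunit_mod_seven {R m : ℕ} (hR : 9 * R + 1 = 10 ^ m)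
    (h : R % 7 = 0 ∨ R % 7 = 4) : Even m := by
  have hr := repunit_mod hR
  clear hR
  rw [Nat.even_iff]
  omega

lemma pow_mod_of_pow_mod_eq_one {a M e : ℕ} (h : (a % M) ^ e % M = 1 % M) (k : ℕ) :
    a ^ k % M = (a % M) ^ (k % e) % M := by
  conv_lhs => rw [← Nat.div_add_mod k e, pow_add, pow_mul, Nat.mul_mod, Nat.pow_mod,
    Nat.pow_mod a e, h, ← Nat.pow_mod, one_pow, Nat.pow_mod a]
  rw [← Nat.mul_mod, one_mul]

lemma mod_seven_of_pow {a k : ℕ} (h : a ^ k % 7 = 1) (hk : ¬ 3 ∣ k) :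
    a % 7 = 1 ∨ (a % 7 = 6 ∧ Even k) := by
  have hk0 : k ≠ 0 := by rintro rfl; simp at hk
  have ha0 : a % 7 ≠ 0 := by
    intro h0
    rw [Nat.pow_mod, h0, zero_pow hk0] at h
    simp at h
  have ha7 : a % 7 < 7 := Nat.mod_lt _ (by norm_num)
  have h6 : (a % 7) ^ 6 % 7 = 1 % 7 := by
    generalize a % 7 = r at *
    interval_cases r <;> simp_all
  rw [pow_mod_of_pow_mod_eq_one h6 k] at h
  have hk6 : k % 6 < 6 := Nat.mod_lt _ (by norm_num)
  have hk3 : k % 6 % 3 ≠ 0 := by omega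
  rw [Nat.even_iff, ← Nat.mod_mod_of_dvd k (show 2 ∣ 6 by norm_num)]
  generalize k % 6 = e at *
  generalize a % 7 = r at *
  interval_cases r <;> interval_cases e <;> simp_all

/-- The residue of `k` modulo `4` is determined by that of `a ^ k` modulo `5` for a primitive
root `a`. -/
lemma mod_four_of_pow_mod_five {a k : ℕ} (ha : a % 5 = 2 ∨ a % 5 = 3) :
    (a ^ k % 5 = 1 → k % 4 = 0) ∧ (a ^ k % 5 = 4 → k % 4 = 2) := by
  have h4 : (a % 5) ^ 4 % 5 = 1 % 5 := by rcases ha with h | h <;> rw [h] <;> norm_num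
  rw [pow_mod_of_pow_mod_eq_one h4 k]
  have hk4 : k % 4 < 4 := Nat.mod_lt _ (by norm_num)
  generalize k % 4 = e at *
  rcases ha with h | h <;> rw [h] <;> interval_cases e <;> simp

lemma pow_mod_eq_one_of_mod_eq_one {a k M : ℕ} (hM : 1 < M) (h : a % M = 1) : a ^ k % M = 1 := by
  rw [Nat.pow_mod, h, one_pow, Nat.mod_eq_of_lt hM]

lemma mod_eq_one_of_dvd_sub_one {p M : ℕ} (hp : 1 ≤ p) (hM : 1 < M) (h : M ∣ p - 1) :
    p % M = 1 := by
  obtain ⟨c, hc⟩ := h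
  rw [show p = 1 + M * c by omega, Nat.add_mul_mod_self_left, Nat.mod_eq_of_lt hM]

lemma mod_eq_one_of_dvd_pow_mul_sub_one {p q g N : ℕ} (hp : p.Prime) (hq : q.Prime)
    (hN : N = p ^ (g + 1)) (h0 : N % q ≠ 0) (h : q ∣ p ^ g * (p - 1)) : N % q = 1 := by
  rcases hq.dvd_mul.mp h with h | h
  · refine absurd (Nat.mod_eq_zero_of_dvd ?_) h0
    rw [hN]
    exact h.trans (pow_dvd_pow p g.le_succ)
  · rw [hN]
    exact pow_mod_eq_one_of_mod_eq_one hq.one_lt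
      (mod_eq_one_of_dvd_sub_one hp.one_le hq.one_lt h)

lemma sixteen_not_dvd_mul_repunit {d R m : ℕ} (hm : 2 ≤ m) (hR : 9 * R + 1 = 10 ^ m)
    (hd1 : 1 ≤ d) (hd9 : d ≤ 9) : ¬ 16 ∣ d * R := by
  intro h
  have h1 := repunit_mod_hundred hm hR
  have h2 : Nat.Coprime (2 ^ 4) R := Nat.Coprime.pow_left 4 (by
    rw [Nat.coprime_two_left, Nat.odd_iff]; omega)
  have := Nat.le_of_dvd hd1 (h2.dvd_of_dvd_mul_right h)
  omega

lemma sub_one_dvd_totient {p n : ℕ} (hp : p.Prime) (h : p ∣ n) : p - 1 ∣ n.totient := by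
  rw [← Nat.totient_prime hp]
  exact Nat.totient_dvd_of_dvd h

/-- If `n > 1` is not a prime power, two distinct prime factors split `φ n`. -/
lemma eq_prime_pow_or_dvd_totient {n : ℕ} (hn : 1 < n) :
    (∃ p g, p.Prime ∧ n = p ^ (g + 1)) ∨
      ∃ p q, p.Prime ∧ q.Prime ∧ p ∣ n ∧ q ∣ n ∧ (p - 1) * (q - 1) ∣ n.totient := by
  obtain ⟨p, hp, hpn⟩ := Nat.exists_prime_and_dvd hn.ne'
  obtain ⟨k, M, hM, rfl⟩ := Nat.exists_eq_pow_mul_and_not_dvd (by omega : n ≠ 0) p hp.ne_one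
  have hk : k ≠ 0 := by
    rintro rfl
    rw [pow_zero, one_mul] at hpn
    exact hM hpn
  by_cases hM1 : M = 1
  · left
    obtain ⟨g, rfl⟩ := Nat.exists_eq_succ_of_ne_zero hk
    exact ⟨p, g, hp, by rw [hM1, mul_one]⟩
  · right
    obtain ⟨q, hq, hqM⟩ := Nat.exists_prime_and_dvd hM1
    refine ⟨p, q, hp, hq, hpn, hqM.mul_left _, ?_⟩
    rw [Nat.totient_mul (((Nat.Prime.coprime_iff_not_dvd hp).mpr hM).pow_left k)]
    exact mul_dvd_mul (sub_one_dvd_totient hp (dvd_pow_self p hk)) (sub_one_dvd_totient hq hqM)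

/-- If `10 ^ m ≡ 1` modulo a prime `p ≡ 1 (mod 8)` with `p ≡ 2 (mod 5)`, then `m` is even. -/
lemma even_of_dvd_ten_pow_sub_one {p m : ℕ} (hp : p.Prime) (h8 : p % 8 = 1) (h5 : p % 5 = 2)
    (h : (10 : ZMod p) ^ m = 1) : Even m := by
  have h2n : ¬ IsSquare ((2 : ℕ) : ZMod 5) := by decide
  by_contra hm
  obtain ⟨k, rfl⟩ := Nat.not_even_iff_odd.mp hm
  have := Fact.mk hp
  have := Fact.mk Nat.prime_five
  have h2 : IsSquare (2 : ZMod p) := (ZMod.exists_sq_eq_two_iff (by omega)).mpr (.inl h8)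
  have h10 : IsSquare (10 : ZMod p) := by
    refine ⟨10 ^ (k + 1), ?_⟩
    rw [← pow_add, show k + 1 + (k + 1) = 2 * k + 1 + 1 by ring, pow_succ, h, one_mul]
  have h20 : (2 : ZMod p) ≠ 0 := by
    intro h0
    have h1 : ((2 : ℕ) : ZMod p) = 0 := by exact_mod_cast h0
    have := Nat.le_of_dvd (by norm_num) ((ZMod.natCast_eq_zero_iff _ _).mp h1)
    omega
  have h5' : IsSquare ((5 : ℕ) : ZMod p) := by
    have e : ((5 : ℕ) : ZMod p) = 10 / 2 := by
      rw [eq_div_iff h20]; norm_num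
    rw [e]
    exact h10.div h2
  rw [ZMod.exists_sq_eq_prime_iff_of_mod_four_eq_one (p := p) (q := 5) (by omega) (by norm_num)]
    at h5'
  rw [← ZMod.natCast_mod, h5] at h5'
  exact h2n h5'

/-- `φ (p ^ (g + 1))` is not a small multiple of a repunit of even length when `g ≥ 3`. -/
lemma not_even_of_pow_mul_eq {p g d R m : ℕ} (hp : p.Prime) (hp5 : 5 ≤ p) (hg : 3 ≤ g)
    (hd : d = 4 ∨ d = 8) (hm : 2 ≤ m) (hR : 9 * R + 1 = 10 ^ m)
    (h : p ^ g * (p - 1) = d * R) : ¬ Even m := by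
  rintro ⟨l, rfl⟩
  obtain ⟨X, hX⟩ : ∃ X, 10 ^ l = X + 1 := ⟨10 ^ l - 1, by
    have := Nat.one_le_pow l 10 (by norm_num); omega⟩
  have hX9 : 9 ≤ X := by
    have := Nat.pow_le_pow_right (show 0 < 10 by norm_num) (show 1 ≤ l by omega)
    omega
  have hRX : 9 * R = X * (X + 2) := by
    rw [pow_add, hX] at hR
    nlinarith
  obtain ⟨s, rfl⟩ : ∃ s, p = s + 1 := ⟨p - 1, by omega⟩
  rw [Nat.add_sub_cancel] at h
  have h9 : (s + 1) ^ g * (9 * s) = d * (X * (X + 2)) := by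
    rw [← hRX]; linarith
  have hcop2 : Nat.Coprime (s + 1) 2 := by
    rw [Nat.coprime_primes hp Nat.prime_two]; omega
  have hcop : Nat.Coprime ((s + 1) ^ g) d := by
    refine Nat.Coprime.pow_left g ?_
    rcases hd with rfl | rfl
    · exact hcop2.pow_right 2
    · exact hcop2.pow_right 3
  have hdvd : (s + 1) ^ g ∣ X * (X + 2) := hcop.dvd_of_dvd_mul_left (Dvd.intro _ h9)
  have hle : (s + 1) ^ g ≤ X + 2 := by
    by_cases hpX : s + 1 ∣ X
    · have : ¬ s + 1 ∣ X + 2 := fun h' => by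
        have := Nat.le_of_dvd (by norm_num) ((Nat.dvd_add_right hpX).mp h')
        omega
      have := ((Nat.Prime.coprime_iff_not_dvd hp).mpr this).pow_left g
      have := Nat.le_of_dvd (by omega) (this.dvd_of_dvd_mul_right hdvd)
      omega
    · have := ((Nat.Prime.coprime_iff_not_dvd hp).mpr hpX).pow_left g
      exact Nat.le_of_dvd (by omega) (this.dvd_of_dvd_mul_left hdvd)
  have h3 : (s + 1) ^ 3 ≤ X + 2 := (Nat.pow_le_pow_right (by omega) hg).trans hle
  have h4 : 4 * X ≤ 9 * s := by
    have h5 : 4 * (X * (X + 2)) ≤ (X + 2) * (9 * s) := by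
      calc 4 * (X * (X + 2)) ≤ d * (X * (X + 2)) := Nat.mul_le_mul_right _ (by omega)
        _ = (s + 1) ^ g * (9 * s) := h9.symm
        _ ≤ (X + 2) * (9 * s) := Nat.mul_le_mul_right _ hle
    nlinarith
  have : 25 * (s + 1) ≤ (s + 1) ^ 3 := by
    rw [pow_succ]; exact Nat.mul_le_mul_right _ (by nlinarith)
  omega

lemma pellP_mod_of_odd {n : ℕ} (hn : Odd n) (h5 : pellP n % 5 ≠ 0) :
    pellP n % 7 = 1 ∧ (pellP n % 5 = 1 ∨
      (pellP n % 5 = 4 ∧ (pellP n % 8 = 1 → pellP n % 11 = 4))) := by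
  rcases pell_mod_of_odd hn with h | h | h | h | h | h | h | h | h | h | h | h <;> omega

lemma pellP_pellQ_mod_of_odd {k : ℕ} (hk : Odd k) (h5 : pellP k % 5 ≠ 0)
    (h8 : pellQ k % 8 = 7) :
    pellQ k % 5 = 4 ∧ (pellP k % 5 = 1 ∨ (pellP k % 5 = 4 ∧
      (pellP k % 8 = 1 → pellP k % 7 = 1 ∧ pellQ k % 7 = 1 ∧
        pellP k % 11 = 4 ∧ pellQ k % 11 = 8))) := by
  rcases pell_mod_of_odd hk with h | h | h | h | h | h | h | h | h | h | h | h <;> omega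

lemma totient_pellP_ne_of_odd {n m d R : ℕ} (hn : Odd n) (hn1 : 1 < n) (hm : 2 ≤ m)
    (hR : 9 * R + 1 = 10 ^ m) (hd1 : 1 ≤ d) (hd9 : d ≤ 9) : (pellP n).totient ≠ d * R := by
  intro hφ
  have h16 := sixteen_not_dvd_mul_repunit hm hR hd1 hd9
  have hR100 := repunit_mod_hundred hm hR
  have hP := one_lt_pellP hn1
  rcases eq_prime_pow_or_dvd_totient hP with ⟨p, g, hp, hpg⟩ | ⟨p, q, hp, hq, hpn, hqn, hpq⟩
  swap
  · have hp4 := prime_mod_four_of_dvd_pellP hn hp hpn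
    have hq4 := prime_mod_four_of_dvd_pellP hn hq hqn
    have h4 : 4 * 4 ∣ (p - 1) * (q - 1) := mul_dvd_mul (by omega) (by omega)
    exact h16 (hφ ▸ h4.trans hpq)
  have hp4 := prime_mod_four_of_dvd_pellP hn hp (hpg ▸ dvd_pow_self p g.succ_ne_zero)
  have h3 := not_three_dvd_of_pellP_eq_pow hn hP hpg
  have hφ' : p ^ g * (p - 1) = d * R := by
    rw [← hφ, hpg, Nat.totient_prime_pow_succ hp]
  have hRodd : Nat.Coprime (2 ^ 2) R := by
    refine Nat.Coprime.pow_left 2 ?_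
    rw [Nat.coprime_two_left, Nat.odd_iff]
    omega
  have hd : d = 4 ∨ d = 8 := by
    have : 4 ∣ d := by
      refine hRodd.dvd_of_dvd_mul_right ?_
      rw [← hφ']
      exact Dvd.dvd.mul_left (by omega) _
    omega
  have hp5 : p ≠ 5 := by
    rintro rfl
    rcases Nat.eq_zero_or_pos g with rfl | hg
    · rcases hd with rfl | rfl <;> omega
    · have : 5 ∣ d * R := hφ' ▸ (dvd_pow_self 5 hg.ne').mul_right _
      rcases hd with rfl | rfl <;> omega
  have hpp : p % 5 ≠ 0 := fun h =>
    hp5 ((Nat.prime_dvd_prime_iff_eq Nat.prime_five hp).mp (Nat.dvd_of_mod_eq_zero h)).symm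
  have hP5 : pellP n % 5 ≠ 0 := fun h =>
    hp5 ((Nat.prime_dvd_prime_iff_eq Nat.prime_five hp).mp
      (Nat.prime_five.dvd_of_dvd_pow (hpg ▸ Nat.dvd_of_mod_eq_zero h))).symm
  obtain ⟨hP7, hP5'⟩ := pellP_mod_of_odd hn hP5
  have hp7 : p % 7 = 1 ∨ (p % 7 = 6 ∧ Even (g + 1)) := by
    rw [hpg] at hP7
    exact mod_seven_of_pow hP7 h3
  have hred : ∀ M, p % M * (d * R % M) % M = (p - 1) % M * (pellP n % M) % M := by
    intro M
    rw [← Nat.mul_mod, ← Nat.mul_mod, ← hφ', hpg]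
    ring_nf
  have hcase : (p % 5 = 4 ∧ pellP n % 5 = 4 ∧ d = 8) ∨
      ((p % 5 = 2 ∧ d = 8 ∨ p % 5 = 3 ∧ d = 4) ∧ pellP n % 5 = 1) := by
    have h5 := hred 5
    rcases hP5' with h | ⟨h, -⟩ <;> rcases hd with rfl | rfl <;> rw [h] at h5
    · rw [show 4 * R % 5 = 4 by omega] at h5; omega
    · rw [show 8 * R % 5 = 3 by omega] at h5; omega
    · rw [show 4 * R % 5 = 4 by omega] at h5; omega
    · rw [show 8 * R % 5 = 3 by omega] at h5; omega
  have hp8 : d = 8 → p % 8 = 1 := by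
    rintro rfl
    have h2p : Nat.Coprime 2 p := by rw [Nat.coprime_two_left, Nat.odd_iff]; omega
    have hc : Nat.Coprime (2 ^ 3) (p ^ g) := Nat.Coprime.pow 3 g h2p
    have : 2 ^ 3 ∣ p - 1 := hc.dvd_of_dvd_mul_left (hφ' ▸ Dvd.intro _ rfl)
    omega
  have h7 := hred 7
  rw [hP7] at h7
  rcases hcase with ⟨h5, hP4, rfl⟩ | ⟨h5, hP1⟩
  · have hP8 : pellP n % 8 = 1 := by
      rw [hpg]
      exact pow_mod_eq_one_of_mod_eq_one (by norm_num) (hp8 rfl)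
    have hP11 : pellP n % 11 = 4 := by
      rcases hP5' with h | ⟨-, h⟩
      · omega
      · exact h hP8
    have hodd : ¬ Even (g + 1) := by
      rintro ⟨j, hj⟩
      have : pellP n % 5 = 1 := by
        rw [hpg, hj, ← two_mul, pow_mul]
        exact pow_mod_eq_one_of_mod_eq_one (by norm_num) (by simp [Nat.pow_mod, h5])
      omega
    have hp71 : p % 7 = 1 := by
      rcases hp7 with h | ⟨-, h⟩
      · exact h
      · exact absurd h hodd
    have h11 : 11 ∣ p ^ g * (p - 1) := by
      rw [hp71, show (p - 1) % 7 = 0 by clear * - hp71; omega, zero_mul, Nat.zero_mod] at h7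
      rw [hφ']
      exact (eleven_dvd_of_seven_dvd hR (by clear * - h7; omega)).mul_left 8
    have h1 := mod_eq_one_of_dvd_pow_mul_sub_one hp (by norm_num) hpg (by simp [hP11]) h11
    rw [hP11] at h1
    norm_num at h1
  · have hg4 : (g + 1) % 4 = 0 := by
      rw [hpg] at hP1
      refine (mod_four_of_pow_mod_five (a := p) ?_).1 hP1
      rcases h5 with ⟨h, -⟩ | ⟨h, -⟩
      · exact .inl h
      · exact .inr h
    refine not_even_of_pow_mul_eq hp (by have := hp.one_lt; clear * - this hp4; omega) (by clear * - hg4; omega) hd hm hR hφ' ?_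
    rcases h5 with ⟨h5, rfl⟩ | ⟨h5, rfl⟩
    · refine even_of_dvd_ten_pow_sub_one hp (hp8 rfl) h5 ?_
      have hpR : p ∣ R := by
        have hc : Nat.Coprime p (2 ^ 3) :=
          Nat.Coprime.pow_right 3 (by rw [Nat.coprime_two_right, Nat.odd_iff]; clear * - hp4; omega)
        exact hc.dvd_of_dvd_mul_left (hφ' ▸ (dvd_pow_self p (by clear * - hg4; omega)).mul_right _)
      have e := congrArg (Nat.cast (R := ZMod p)) hR
      push_cast at e
      rw [(ZMod.natCast_eq_zero_iff _ _).mpr hpR] at e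
      rw [← e]
      ring
    · refine even_of_repunit_mod_seven hR ?_
      rcases hp7 with h | ⟨h, -⟩
      · rw [h, show (p - 1) % 7 = 0 by clear * - h; omega] at h7
        clear * - h7
        omega
      · rw [h, show (p - 1) % 7 = 5 by clear * - h; omega] at h7
        clear * - h7
        omega

lemma pow_mul_sub_one_mul_ne {k m R p q g f : ℕ} (hk : Odd k) (hk1 : 1 < k)
    (hR : 9 * R + 1 = 10 ^ m) (hR100 : R % 100 = 11) (hp : p.Prime) (hq : q.Prime)
    (hpg : pellP k = p ^ (g + 1)) (hqf : pellQ k = q ^ (f + 1)) (hp4 : p % 4 = 1)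
    (hq7 : q % 8 = 7) : p ^ g * (p - 1) * (q ^ f * (q - 1)) ≠ 8 * R := by
  intro hφ'
  have hQ := one_lt_pellQ hk1
  have hf3 := not_three_dvd_of_pellQ_eq_pow hk hQ hqf
  have hf2 := not_even_of_pellQ_eq_pow hk hQ hqf
  obtain ⟨j, hj⟩ := Nat.not_even_iff_odd.mp hf2
  have hQ8 : pellQ k % 8 = 7 := by
    rw [hqf, hj, pow_succ, pow_mul, Nat.mul_mod,
      pow_mod_eq_one_of_mod_eq_one (by norm_num) (by simp [Nat.pow_mod, hq7]), hq7]
  have hp5 : p ≠ 5 := by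
    rintro rfl
    rcases Nat.eq_zero_or_pos g with rfl | hg
    · have h3 : k = 3 := strictMono_pellP.injective (by rw [hpg]; simp [pellP])
      subst h3
      rw [← Nat.totient_prime_pow_succ hq, ← hqf, show pellQ 3 = 7 by simp [pellQ],
        Nat.totient_prime (by norm_num)] at hφ'
      omega
    · have : 5 ∣ 8 * R := hφ' ▸ ((dvd_pow_self 5 hg.ne').mul_right _).mul_right _
      omega
  have hP5 : pellP k % 5 ≠ 0 := fun h =>
    hp5 ((Nat.prime_dvd_prime_iff_eq Nat.prime_five hp).mp
      (Nat.prime_five.dvd_of_dvd_pow (hpg ▸ Nat.dvd_of_mod_eq_zero h))).symm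
  have hPQ5 := pellP_pellQ_mod_of_odd hk hP5 hQ8
  have hq5 : q % 5 = 4 := by
    have h := hPQ5.1
    rw [hqf, hj, pow_succ, pow_mul, Nat.mul_mod, Nat.pow_mod, Nat.pow_mod q 2] at h
    have hq5 : q % 5 < 5 := Nat.mod_lt _ (by norm_num)
    have h1 : (4 : ℕ) ^ j % 5 = 1 ∨ (4 : ℕ) ^ j % 5 = 4 := by
      rw [pow_mod_of_pow_mod_eq_one (e := 2) (by norm_num)]
      rcases Nat.mod_two_eq_zero_or_one j with h | h <;> rw [h] <;> norm_num
    generalize q % 5 = r at *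
    interval_cases r <;> (try rfl) <;> (exfalso; norm_num at h; try omega)
  have hred : ∀ M, p % M * (q % M) % M * (8 * R % M) % M =
      (p - 1) % M * ((q - 1) % M) % M * (pellP k % M * (pellQ k % M) % M) % M := by
    intro M
    simp only [Nat.mod_mul_mod, Nat.mul_mod_mod]
    rw [← hφ', hpg, hqf]
    ring_nf
  have h5 := hred 5
  rw [show 8 * R % 5 = 3 by clear * - hR100; omega, hq5,
    show (q - 1) % 5 = 3 by clear * - hq5; omega, hPQ5.1] at h5
  obtain ⟨-, hP1 | ⟨hP4, hrest⟩⟩ := hPQ5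
  · rw [hP1] at h5
    clear * - h5 hp4
    omega
  rw [hP4] at h5
  have hg2 : (g + 1) % 4 = 2 := by
    have hp53 : p % 5 = 3 := by clear * - h5 hp4; omega
    rw [hpg] at hP4
    exact (mod_four_of_pow_mod_five (.inr hp53)).2 hP4
  obtain ⟨i, hi⟩ : ∃ i, g + 1 = 2 * i := ⟨(g + 1) / 2, by clear * - hg2; omega⟩
  have hP8 : pellP k % 8 = 1 := by
    have : p % 8 = 1 ∨ p % 8 = 5 := by clear * - hp4; omega
    rw [hpg, hi, pow_mul]
    refine pow_mod_eq_one_of_mod_eq_one (by norm_num) ?_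
    rcases this with h | h <;> simp [Nat.pow_mod, h]
  obtain ⟨-, hQ7, hP11, hQ11⟩ := hrest hP8
  have hq71 : q % 7 = 1 := by
    rw [hqf] at hQ7
    rcases mod_seven_of_pow hQ7 hf3 with h | ⟨-, h⟩
    · exact h
    · exact absurd h hf2
  have h7 : 7 ∣ 8 * R := by
    rw [← hφ']
    exact ((show 7 ∣ q - 1 by clear * - hq71; omega).mul_left _).mul_left _
  have h11 : 11 ∣ p ^ g * (p - 1) * (q ^ f * (q - 1)) := by
    rw [hφ']
    exact (eleven_dvd_of_seven_dvd hR (by clear * - h7; omega)).mul_left 8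
  have hp11 : Nat.Prime 11 := by norm_num
  rcases hp11.dvd_mul.mp h11 with h | h
  · have h1 := mod_eq_one_of_dvd_pow_mul_sub_one hp hp11 hpg (by simp [hP11]) h
    rw [hP11] at h1
    norm_num at h1
  · have h1 := mod_eq_one_of_dvd_pow_mul_sub_one hq hp11 hqf (by simp [hQ11]) h
    rw [hQ11] at h1
    norm_num at h1

lemma totient_pellP_two_mul_ne_of_odd {k m d R : ℕ} (hk : Odd k) (hk1 : 1 < k) (hm : 2 ≤ m)
    (hR : 9 * R + 1 = 10 ^ m) (hd1 : 1 ≤ d) (hd9 : d ≤ 9) :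
    (pellP (2 * k)).totient ≠ d * R := by
  intro hφ
  have h16 := sixteen_not_dvd_mul_repunit hm hR hd1 hd9
  have hR100 := repunit_mod_hundred hm hR
  have hP := one_lt_pellP hk1
  have hQ := one_lt_pellQ hk1
  have hPQ := coprime_pellP_pellQ hk
  have hQ2 := pellQ_odd hk
  have hmul : (pellP k).totient * (pellQ k).totient = d * R := by
    rw [← hφ, pellP_two_mul, Nat.totient_mul, Nat.totient_two, one_mul, Nat.totient_mul hPQ]
    rw [Nat.coprime_two_left, Nat.odd_mul, Nat.odd_iff, Nat.odd_iff]
    have := pellP_mod_four hk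
    omega
  rcases eq_prime_pow_or_dvd_totient hP with ⟨p, g, hp, hpg⟩ | ⟨p, q, hp, hq, hpn, hqn, hpq⟩
  swap
  · have hp4 := prime_mod_four_of_dvd_pellP hk hp hpn
    have hq4 := prime_mod_four_of_dvd_pellP hk hq hqn
    have h4 : 4 * 4 ∣ (p - 1) * (q - 1) := mul_dvd_mul (by omega) (by omega)
    exact h16 (hmul ▸ (h4.trans hpq).mul_right _)
  have hpP : p ∣ pellP k := hpg ▸ dvd_pow_self p g.succ_ne_zero
  have hp4 := prime_mod_four_of_dvd_pellP hk hp hpP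
  have hpφ : p - 1 ∣ (pellP k).totient := sub_one_dvd_totient hp hpP
  rcases eq_prime_pow_or_dvd_totient hQ with ⟨q, f, hq, hqf⟩ | ⟨q, r, hq, hr, hqn, hrn, hqr⟩
  swap
  · have hq8 := prime_mod_eight_of_dvd_pellQ hk hq hqn
    have hr8 := prime_mod_eight_of_dvd_pellQ hk hr hrn
    have h4 : 2 * 2 ∣ (q - 1) * (r - 1) := mul_dvd_mul (by omega) (by omega)
    have h4' : 4 * (2 * 2) ∣ (pellP k).totient * (pellQ k).totient :=
      mul_dvd_mul (Dvd.dvd.trans (by omega) hpφ) (h4.trans hqr)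
    exact h16 (hmul ▸ h4')
  have hqQ : q ∣ pellQ k := hqf ▸ dvd_pow_self q f.succ_ne_zero
  have hq8 := prime_mod_eight_of_dvd_pellQ hk hq hqQ
  have hqφ : q - 1 ∣ (pellQ k).totient := sub_one_dvd_totient hq hqQ
  have hq7 : q % 8 = 7 := by
    rcases hq8 with h | h
    · have h4 : 4 * 4 ∣ (pellP k).totient * (pellQ k).totient :=
        mul_dvd_mul (Dvd.dvd.trans (by omega) hpφ) (Dvd.dvd.trans (by omega) hqφ)
      exact absurd (hmul ▸ h4) h16
    · exact h
  have hd : d = 8 := by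
    have h8 : 4 * 2 ∣ (pellP k).totient * (pellQ k).totient :=
      mul_dvd_mul (Dvd.dvd.trans (by omega) hpφ) (Dvd.dvd.trans (by omega) hqφ)
    have hRodd : Nat.Coprime (2 ^ 3) R :=
      Nat.Coprime.pow_left 3 (by rw [Nat.coprime_two_left, Nat.odd_iff]; omega)
    have := hRodd.dvd_of_dvd_mul_right (hmul ▸ h8)
    omega
  subst hd
  have hφ' : p ^ g * (p - 1) * (q ^ f * (q - 1)) = 8 * R := by
    rw [← hmul, hpg, hqf, Nat.totient_prime_pow_succ hp, Nat.totient_prime_pow_succ hq]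
  exact pow_mul_sub_one_mul_ne hk hk1 hR hR100 hp hq hpg hqf hp4 hq7 hφ'

lemma sixteen_dvd_totient_pellP {t : ℕ} (ht : 1 < t) : 16 ∣ (pellP (4 * t)).totient := by
  rcases Nat.even_or_odd' t with ⟨u, rfl | rfl⟩
  · have h : pellP 8 ∣ pellP (4 * (2 * u)) := by
      rw [show 4 * (2 * u) = 8 * u by ring]
      exact pellP_dvd_pellP_mul 8 u
    refine Dvd.dvd.trans ?_ (Nat.totient_dvd_of_dvd h)
    rw [show pellP 8 = 2 ^ 3 * (3 * 17) by simp [pellP], Nat.totient_mul (by norm_num),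
      Nat.totient_mul (by norm_num), Nat.totient_prime_pow Nat.prime_two (by norm_num),
      Nat.totient_prime Nat.prime_three, Nat.totient_prime (by norm_num)]
    norm_num
  · have ht : Odd (2 * u + 1) := odd_two_mul_add_one u
    have hc : Nat.Coprime (2 ^ 2 * 3) (pellP (2 * u + 1)) := by
      refine Nat.Coprime.mul_left (Nat.Coprime.pow_left 2 ?_) ?_
      · rw [Nat.coprime_two_left, Nat.odd_iff]
        have := pellP_mod_four ht
        omega
      · exact (Nat.Prime.coprime_iff_not_dvd Nat.prime_three).mpr (pellP_not_three_dvd ht)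
    have h1 : pellP 4 ∣ pellP (4 * (2 * u + 1)) := pellP_dvd_pellP_mul _ _
    have h2 : pellP (2 * u + 1) ∣ pellP (4 * (2 * u + 1)) := by
      rw [mul_comm 4]; exact pellP_dvd_pellP_mul _ _
    rw [show pellP 4 = 2 ^ 2 * 3 by simp [pellP]] at h1
    refine Dvd.dvd.trans ?_ (Nat.totient_dvd_of_dvd (hc.mul_dvd_of_dvd_of_dvd h1 h2))
    rw [Nat.totient_mul hc, Nat.totient_mul (by norm_num),
      Nat.totient_prime_pow Nat.prime_two (by norm_num), Nat.totient_prime Nat.prime_three]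
    obtain ⟨p, hp, hpn⟩ := Nat.exists_prime_and_dvd (one_lt_pellP (n := 2 * u + 1) (by omega)).ne'
    have hp4 := prime_mod_four_of_dvd_pellP ht hp hpn
    have : 4 ∣ (pellP (2 * u + 1)).totient :=
      Dvd.dvd.trans (by omega) (sub_one_dvd_totient hp hpn)
    norm_num
    omega

theorem no_repdigit_totient_pellP :
    ¬ ∃ (n m d : ℕ), 0 < n ∧ 2 ≤ m ∧ 1 ≤ d ∧ d ≤ 9 ∧
      9 * Nat.totient (pellP n) = d * (10 ^ m - 1) := by
  rintro ⟨n, m, d, hn, hm, hd1, hd9, h⟩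
  obtain ⟨R, hR⟩ : ∃ R, 9 * R + 1 = 10 ^ m := by
    have h1 : 10 ^ m % 9 = 1 := pow_mod_eq_one_of_mod_eq_one (by norm_num) (by norm_num)
    exact ⟨10 ^ m / 9, by omega⟩
  have hφ : (pellP n).totient = d * R := by
    rw [← hR, Nat.add_sub_cancel] at h
    linarith
  have hlarge : 11 ≤ d * R := by
    have := repunit_mod_hundred hm hR
    calc 11 ≤ R := by omega
      _ ≤ d * R := Nat.le_mul_of_pos_left R hd1
  rcases Nat.even_or_odd' n with ⟨k, rfl | rfl⟩
  · rcases Nat.even_or_odd' k with ⟨t, rfl | rfl⟩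
    · rw [← mul_assoc] at hφ
      rcases (show t = 1 ∨ 1 < t by omega) with rfl | ht
      · have : (pellP (2 * 2 * 1)).totient = 4 := by simp [pellP]; decide
        omega
      · exact sixteen_not_dvd_mul_repunit hm hR hd1 hd9 (hφ ▸ sixteen_dvd_totient_pellP ht)
    · rcases Nat.eq_zero_or_pos t with rfl | ht
      · simp [pellP] at hφ
        omega
      · exact totient_pellP_two_mul_ne_of_odd (odd_two_mul_add_one t) (by omega) hm hR hd1 hd9 hφ
  · rcases Nat.eq_zero_or_pos k with rfl | hk
    · simp [pellP] at hφ
      omega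
    · exact totient_pellP_ne_of_odd (odd_two_mul_add_one k) (by omega) hm hR hd1 hd9 hφ
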